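/- Let X be a finite abstract simplicial complex of dimension d, let f ∈ Ω^{d-1}(X), and let τ ∈ X^{d-2}. Define f_τ : (lk τ)^0 → ℝ by f_τ(v) = f(vτ), a 0-form on the link graph lk τ. Then ⟨Δ+_τ f, f⟩ = ⟨Δ+_{lk τ} f_τ, f_τ⟩, where Δ+_{lk τ} is the graph Laplacian of lk τ and Δ+_τ is the local operator (Δ+_τ f)(σ) = deg_τ(σ) f(σ) − Σ_{σ'∼σ, τ⊆σ'} f(σ') for τ ⊂ σ and 0 otherwise. -/

import Mathlib

open Finset

/-- A finite abstract simplicial complex on the vertex type `V`: a collection of finite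
subsets of `V` (the cells), closed under taking subsets and containing the empty cell. -/
structure SComplex (V : Type) [Fintype V] [DecidableEq V] : Type where
  cells : Finset (Finset V)
  empty_mem : ∅ ∈ cells
  down_closed : ∀ s ∈ cells, ∀ t ⊆ s, t ∈ cells

namespace SComplex

variable {V : Type} [Fintype V] [DecidableEq V]

/-- The cells of `X` with exactly `m` vertices, i.e. the `(m-1)`-dimensional cells `X^{m-1}`. -/
def cellsCard (X : SComplex V) (m : ℕ) : Finset (Finset V) :=
  X.cells.filter fun s => s.card = m

/-- `X` is `D`-dimensional: every cell has at most `D+1` vertices and some cell has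
exactly `D+1` vertices. -/
def Dim (X : SComplex V) (D : ℕ) : Prop :=
  (∀ s ∈ X.cells, s.card ≤ D + 1) ∧ ∃ s ∈ X.cells, s.card = D + 1

/-- `X` (of dimension `D`) has a complete skeleton: every subset of `V` with at most `D`
elements is a cell. -/
def CompleteSkeleton (X : SComplex V) (D : ℕ) : Prop :=
  ∀ s : Finset V, s.card ≤ D → s ∈ X.cells

/-- The set of vertices of an ordered tuple. -/
def tset {m : ℕ} (σ : Fin m → V) : Finset V := Finset.image σ Finset.univ

/-- An ordered tuple of vertices is an oriented cell when it is injective and its vertex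
set is a cell of `X`. -/
def IsCell (X : SComplex V) {m : ℕ} (σ : Fin m → V) : Prop :=
  Function.Injective σ ∧ tset σ ∈ X.cells

instance (X : SComplex V) {m : ℕ} (σ : Fin m → V) : Decidable (X.IsCell σ) := by
  unfold IsCell; infer_instance

/-- `X.nbr v σ` : the vertex `v` does not belong to `σ` and together with `σ` spans a
cell of `X`. -/
def nbr (X : SComplex V) {m : ℕ} (v : V) (σ : Fin m → V) : Prop :=
  v ∉ tset σ ∧ insert v (tset σ) ∈ X.cells

instance (X : SComplex V) {m : ℕ} (v : V) (σ : Fin m → V) : Decidable (X.nbr v σ) := by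
  unfold nbr; infer_instance

/-- `f` is an `(m-1)`-form on `X`: a function on ordered tuples of `m` vertices which is
skew-symmetric with respect to permutations of the tuple, and is supported on the
oriented `(m-1)`-cells of `X`. -/
def IsForm (X : SComplex V) (m : ℕ) (f : (Fin m → V) → ℝ) : Prop :=
  (∀ (σ : Fin m → V) (π : Equiv.Perm (Fin m)),
      f (σ ∘ π) = ((Equiv.Perm.sign π : ℤ) : ℝ) * f σ) ∧
  ∀ σ : Fin m → V, ¬ X.IsCell σ → f σ = 0

/-- The space `Ω^{m-1}(X)` of `(m-1)`-forms, as a submodule of the functions on tuples. -/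
def formSub (X : SComplex V) (m : ℕ) : Submodule ℝ ((Fin m → V) → ℝ) where
  carrier := {f | X.IsForm m f}
  add_mem' := @fun f g hf hg => ⟨fun σ π => by
      simp only [Pi.add_apply, hf.1 σ π, hg.1 σ π]; ring,
    fun σ h => by simp only [Pi.add_apply, hf.2 σ h, hg.2 σ h, add_zero]⟩
  zero_mem' := ⟨fun σ π => by simp, fun σ h => rfl⟩
  smul_mem' := @fun c f hf => ⟨fun σ π => by
      simp only [Pi.smul_apply, smul_eq_mul, hf.1 σ π]; ring,
    fun σ h => by simp only [Pi.smul_apply, hf.2 σ h, smul_eq_mul, mul_zero]⟩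

/-- The inner product `⟨f,g⟩ = ∑_{σ ∈ X^{m-1}} f(σ) g(σ)` on `(m-1)`-forms, computed via
ordered tuples (each cell is counted `m!` times, once for each ordering of its vertices). -/
noncomputable def innerForm (m : ℕ) (f g : (Fin m → V) → ℝ) : ℝ :=
  ((m.factorial : ℝ))⁻¹ * ∑ σ : Fin m → V, f σ * g σ

/-- The boundary operator `∂ : Ω^m → Ω^{m-1}`, `(∂f)(σ) = ∑_{v ∼ σ} f(vσ)`. -/
def bdry (X : SComplex V) (m : ℕ) (f : (Fin (m+1) → V) → ℝ) : (Fin m → V) → ℝ :=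
  fun σ => ∑ v : V, if X.nbr v σ then f (Fin.cons v σ) else 0

/-- The coboundary operator `∂* : Ω^{m-1} → Ω^m`, `(∂*f)(σ) = ∑ i (-1)^i f(σ ∖ σᵢ)`,
supported on the oriented `m`-cells of `X`. -/
def cobdry (X : SComplex V) (m : ℕ) (f : (Fin m → V) → ℝ) : (Fin (m+1) → V) → ℝ :=
  fun σ => if X.IsCell σ then ∑ i : Fin (m+1), (-1 : ℝ) ^ (i : ℕ) * f (σ ∘ i.succAbove) else 0

/-- The upper Laplacian `Δ⁺ = ∂ ∘ ∂*` on `(m-1)`-forms. -/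
def upLap (X : SComplex V) (m : ℕ) (f : (Fin m → V) → ℝ) : (Fin m → V) → ℝ :=
  X.bdry m (X.cobdry m f)

/-- The lower Laplacian `Δ⁻ = ∂* ∘ ∂` on `m`-forms. -/
def lowLap (X : SComplex V) (m : ℕ) (f : (Fin (m+1) → V) → ℝ) : (Fin (m+1) → V) → ℝ :=
  X.cobdry m (X.bdry m f)

/-- The boundary operator as a linear map. -/
def bdryL (X : SComplex V) (m : ℕ) : ((Fin (m+1) → V) → ℝ) →ₗ[ℝ] ((Fin m → V) → ℝ) where
  toFun := X.bdry m
  map_add' f g := by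
    funext σ
    show (∑ v : V, if X.nbr v σ then (f + g) (Fin.cons v σ) else 0) =
      (∑ v : V, if X.nbr v σ then f (Fin.cons v σ) else 0) +
      (∑ v : V, if X.nbr v σ then g (Fin.cons v σ) else 0)
    rw [← Finset.sum_add_distrib]
    exact Finset.sum_congr rfl fun v _ => by by_cases h : X.nbr v σ <;> simp [h]
  map_smul' c f := by
    funext σ
    show (∑ v : V, if X.nbr v σ then (c • f) (Fin.cons v σ) else 0) =
      c * (∑ v : V, if X.nbr v σ then f (Fin.cons v σ) else 0)
    rw [Finset.mul_sum]
    exact Finset.sum_congr rfl fun v _ => by by_cases h : X.nbr v σ <;> simp [h]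

/-- The coboundary operator as a linear map. -/
def cobdryL (X : SComplex V) (m : ℕ) : ((Fin m → V) → ℝ) →ₗ[ℝ] ((Fin (m+1) → V) → ℝ) where
  toFun := X.cobdry m
  map_add' f g := by
    funext σ
    show X.cobdry m (f + g) σ = X.cobdry m f σ + X.cobdry m g σ
    unfold cobdry
    by_cases h : X.IsCell σ
    · simp only [h, if_true, ← Finset.sum_add_distrib]
      exact Finset.sum_congr rfl fun i _ => by simp [Pi.add_apply]; ring
    · simp [h]
  map_smul' c f := by
    funext σ
    show X.cobdry m (c • f) σ = c * X.cobdry m f σ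
    unfold cobdry
    by_cases h : X.IsCell σ
    · simp only [h, if_true, Finset.mul_sum]
      exact Finset.sum_congr rfl fun i _ => by simp [Pi.smul_apply]; ring
    · simp [h]

/-- The degree of a cell `s`: the number of cells with one more vertex containing `s`. -/
def degCell (X : SComplex V) (s : Finset V) : ℕ :=
  (X.cells.filter fun t => s ⊆ t ∧ t.card = s.card + 1).card

/-- The maximal degree of an `(m-1)`-cell of `X`. -/
def maxDeg (X : SComplex V) (m : ℕ) : ℕ :=
  (X.cellsCard m).sup fun s => X.degCell s

/-- The spectrum of the upper Laplacian of a `(d+1)`-dimensional complex restricted to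
the cycle space `Z = ker ∂` inside the space of forms on `d+1` vertices. -/
def specUpLapZ (X : SComplex V) (d : ℕ) : Set ℝ :=
  {μ | ∃ f : (Fin (d+1) → V) → ℝ,
    X.IsForm (d+1) f ∧ X.bdry d f = 0 ∧ f ≠ 0 ∧ X.upLap (d+1) f = μ • f}

/-- The spectral gap `λ(X) = min Spec (Δ⁺|_Z)` of a `(d+1)`-dimensional complex. -/
noncomputable def spectralGap (X : SComplex V) (d : ℕ) : ℝ :=
  sInf (X.specUpLapZ d)

/-- `F(A 0, …, A (m-1))`: the set of cells with `m` vertices having exactly one vertex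
in each `A i`. -/
def Fcells (X : SComplex V) {m : ℕ} (A : Fin m → Finset V) : Finset (Finset V) :=
  X.cells.filter fun s => s.card = m ∧ ∀ i, (s ∩ A i).card = 1

/-- The Cheeger constant of a `(d+1)`-dimensional complex: the minimum over all
partitions of the vertex set into `d+2` nonempty parts of `n·|F(A₀,…)|/∏|Aᵢ|`. -/
noncomputable def cheeger (X : SComplex V) (d : ℕ) : ℝ :=
  sInf { r : ℝ | ∃ A : Fin (d+2) → Finset V,
    (∀ i, (A i).Nonempty) ∧ (∀ i j, i ≠ j → Disjoint (A i) (A j)) ∧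
    Finset.univ.biUnion A = Finset.univ ∧
    r = (Fintype.card V : ℝ) * ((X.Fcells A).card : ℝ) / ∏ i, ((A i).card : ℝ) }

/-- The `m`-th reduced Betti number `β_m = dim H_m` of `X` over `ℝ`:
`dim (Ω^m ∩ ker ∂_m) - dim (∂_{m+1} Ω^{m+1})`. -/
noncomputable def betti (X : SComplex V) (m : ℕ) : ℕ :=
  Module.finrank ℝ ↥(X.formSub (m+1) ⊓ LinearMap.ker (X.bdryL m)) -
  Module.finrank ℝ ↥(Submodule.map (X.bdryL (m+1)) (X.formSub (m+2)))

/-- The vertices of the link of `τ`. -/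
def linkVerts (X : SComplex V) (τ : Finset V) : Finset V :=
  Finset.univ.filter fun v => v ∉ τ ∧ insert v τ ∈ X.cells

/-- The neighbours of `v` in the link graph of `τ`. -/
def linkNbrs (X : SComplex V) (τ : Finset V) (v : V) : Finset V :=
  Finset.univ.filter fun w => w ≠ v ∧ w ∉ τ ∧ v ∉ τ ∧ insert v (insert w τ) ∈ X.cells

/-- The graph Laplacian of the link of `τ`. -/
def linkLap (X : SComplex V) (τ : Finset V) (g : V → ℝ) : V → ℝ :=
  fun v => ((X.linkNbrs τ v).card : ℝ) * g v - ∑ w ∈ X.linkNbrs τ v, g w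

/-- The graph spectral gap of the link of `τ`: the minimal eigenvalue of its graph
Laplacian on functions on its vertices summing to zero. -/
noncomputable def linkGap (X : SComplex V) (τ : Finset V) : ℝ :=
  sInf {μ : ℝ | ∃ g : V → ℝ, (∀ v, v ∉ X.linkVerts τ → g v = 0) ∧
    (∑ v ∈ X.linkVerts τ, g v = 0) ∧ g ≠ 0 ∧
    ∀ v ∈ X.linkVerts τ, X.linkLap τ g v = μ * g v}

/-- The graph Cheeger constant of the link of `τ`: the minimum over partitions
`B ⊔ C` of its vertex set of `|W|·|E(B,C)|/(|B|·|C|)`. -/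
noncomputable def linkCheeger (X : SComplex V) (τ : Finset V) : ℝ :=
  sInf { r : ℝ | ∃ B C : Finset V, B.Nonempty ∧ C.Nonempty ∧ Disjoint B C ∧
    B ∪ C = X.linkVerts τ ∧
    r = ((X.linkVerts τ).card : ℝ) *
        (((B ×ˢ C).filter fun p => insert p.1 (insert p.2 τ) ∈ X.cells).card : ℝ) /
        ((B.card : ℝ) * (C.card : ℝ)) }

/-- `deg_τ(s)`: the number of neighbours `s'` of the cell `s` which contain `τ` (two
distinct cells with the same number of vertices are neighbours when their union is a
cell of `X` with one more vertex). -/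
def degTau (X : SComplex V) (τ s : Finset V) : ℕ :=
  (X.cells.filter fun s' => s'.card = s.card ∧ s' ≠ s ∧ τ ⊆ s' ∧
    (s ∪ s').card = s.card + 1 ∧ s ∪ s' ∈ X.cells).card

/-- The local upper Laplacian `Δ⁺_τ` associated to a cell `τ` with `d` vertices of a
`(d+1)`-dimensional complex, acting on forms on `d+1` vertices:
`(Δ⁺_τ f)(σ) = deg_τ(σ) f(σ) - ∑_{σ' ∼ σ, τ ⊆ σ'} f(σ')` when `τ ⊆ σ`, and `0` else. -/
def localUpLap (X : SComplex V) (d : ℕ) (τ : Finset V) (f : (Fin (d+1) → V) → ℝ) :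
    (Fin (d+1) → V) → ℝ :=
  fun σ => if τ ⊆ tset σ then
      (X.degTau τ (tset σ) : ℝ) * f σ -
        ∑ v : V, if X.nbr v σ then
          ∑ i : Fin (d+1), if σ i ∉ τ then
            (-1 : ℝ) ^ (i : ℕ) * f (Fin.cons v σ ∘ Fin.succAbove i.succ) else 0
        else 0
    else 0

/-- The complement complex `X̄` of a `D`-dimensional complex `X` with complete skeleton:
it has the same cells of dimension `< D`, and its `D`-dimensional cells are exactly the
vertex sets of size `D+1` which are not cells of `X`. -/
def complComplex (X : SComplex V) (D : ℕ) (hX : X.CompleteSkeleton D) : SComplex V where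
  cells := (X.cells.filter fun s => s.card ≤ D) ∪
    ((Finset.univ : Finset V).powersetCard (D+1)).filter fun s => s ∉ X.cells
  empty_mem := Finset.mem_union_left _ (Finset.mem_filter.mpr ⟨X.empty_mem, by simp⟩)
  down_closed := by
    intro s hs t ht
    rcases Finset.mem_union.mp hs with h | h
    · rw [Finset.mem_filter] at h
      exact Finset.mem_union_left _ (Finset.mem_filter.mpr
        ⟨X.down_closed s h.1 t ht, le_trans (Finset.card_le_card ht) h.2⟩)
    · rw [Finset.mem_filter, Finset.mem_powersetCard] at h
      by_cases hts : t = s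
      · subst hts
        exact Finset.mem_union_right _ (Finset.mem_filter.mpr
          ⟨Finset.mem_powersetCard.mpr h.1, h.2⟩)
      · have hlt : t.card < s.card := Finset.card_lt_card (ht.ssubset_of_ne hts)
        have hsD : s.card = D + 1 := h.1.2
        have htD : t.card ≤ D := by omega
        exact Finset.mem_union_left _ (Finset.mem_filter.mpr ⟨hX t htD, htD⟩)

/-- The simplicial complex on `V` with complete `(d+1)`-dimensional skeleton whose
top-dimensional cells (with `d+2` vertices) are the members of `T`: the Linial–Meshulam
complex determined by the sample `T`. -/
def lmComplex (V : Type) [Fintype V] [DecidableEq V] (d : ℕ) (T : Finset (Finset V)) :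
    SComplex V where
  cells := (Finset.univ.powerset.filter fun s : Finset V => s.card ≤ d + 1) ∪
    T.filter fun s => s.card = d + 2
  empty_mem := Finset.mem_union_left _ (by simp)
  down_closed := by
    intro s hs t ht
    rcases Finset.mem_union.mp hs with h | h
    · rw [Finset.mem_filter] at h
      exact Finset.mem_union_left _ (Finset.mem_filter.mpr
        ⟨Finset.mem_powerset.mpr (Finset.subset_univ t), le_trans (Finset.card_le_card ht) h.2⟩)
    · rw [Finset.mem_filter] at h
      by_cases hts : t = s
      · subst hts; exact Finset.mem_union_right _ (Finset.mem_filter.mpr h)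
      · have hlt : t.card < s.card := Finset.card_lt_card (ht.ssubset_of_ne hts)
        have hsd : s.card = d + 2 := h.2
        have htd : t.card ≤ d + 1 := by omega
        exact Finset.mem_union_left _ (Finset.mem_filter.mpr
          ⟨Finset.mem_powerset.mpr (Finset.subset_univ t), htd⟩)

open Classical in
/-- The probability, under the Linial–Meshulam measure `X(d+1, n, p)` (each possible
top-dimensional cell on `d+2` vertices is included independently with probability `p`),
of an event `E` depending on the set of top-dimensional cells. -/
noncomputable def lmProb (V : Type) [Fintype V] [DecidableEq V] (d : ℕ) (p : ℝ)
    (E : Finset (Finset V) → Prop) : ℝ :=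
  ∑ T ∈ ((Finset.univ : Finset V).powersetCard (d+2)).powerset,
    if E T then
      p ^ T.card * (1 - p) ^ (((Finset.univ : Finset V).powersetCard (d+2)).card - T.card)
    else 0

end SComplex

namespace SComplex

theorem sign_mul_self {m : ℕ} (π : Equiv.Perm (Fin m)) :
    ((Equiv.Perm.sign π : ℤ) : ℝ) * ((Equiv.Perm.sign π : ℤ) : ℝ) = 1 := by
  rcases Int.units_eq_one_or (Equiv.Perm.sign π) with h | h <;> simp [h]

variable {V : Type} [DecidableEq V]

theorem tset_comp_perm {m : ℕ} (σ : Fin m → V) (π : Equiv.Perm (Fin m)) :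
    tset (σ ∘ π) = tset σ := by
  ext x
  simp only [tset, mem_image, mem_univ, true_and, Function.comp_apply]
  exact (π.surjective.exists (p := fun i => σ i = x)).symm

theorem tset_cons {m : ℕ} (v : V) (σ : Fin m → V) :
    tset (Fin.cons v σ : Fin (m + 1) → V) = insert v (tset σ) := by
  ext x
  simp [tset, Fin.exists_fin_succ, eq_comm]

theorem mem_tset {m : ℕ} (σ : Fin m → V) (i : Fin m) : σ i ∈ tset σ :=
  mem_image_of_mem _ (mem_univ i)

theorem card_tset {m : ℕ} {σ : Fin m → V} (hσ : Function.Injective σ) :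
    (tset σ).card = m := by
  simp [tset, card_image_of_injective _ hσ]

theorem cons_injective_of_notMem {m : ℕ} {v : V} {σ : Fin m → V}
    (hσ : Function.Injective σ) (hv : v ∉ tset σ) :
    Function.Injective (Fin.cons v σ : Fin (m + 1) → V) := by
  refine Fin.cons_injective_iff.2 ⟨?_, hσ⟩
  rintro ⟨i, rfl⟩
  exact hv (mem_tset σ i)

/-- Two injective tuples with the same vertex set differ by a permutation. -/
theorem exists_perm_of_tset_eq {m : ℕ} {σ ρ : Fin m → V} (hσ : Function.Injective σ)
    (h : tset ρ = tset σ) : ∃ π : Equiv.Perm (Fin m), ρ ∘ π = σ := by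
  have hmem : ∀ i, ∃ j, ρ j = σ i := fun i => by
    have hi : σ i ∈ tset ρ := h ▸ mem_tset σ i
    simpa [tset] using hi
  choose g hg using hmem
  have hinj : Function.Injective g := fun i j hij => hσ (by rw [← hg i, ← hg j, hij])
  exact ⟨Equiv.ofBijective g (Finite.injective_iff_bijective.1 hinj), funext hg⟩

variable [Fintype V]

theorem nbr_comp_perm (X : SComplex V) {m : ℕ} (v : V) (σ : Fin m → V)
    (π : Equiv.Perm (Fin m)) : X.nbr v (σ ∘ π) ↔ X.nbr v σ := by
  rw [nbr, nbr, tset_comp_perm]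

/-- Replacing the `i`-th vertex of `σ` by `v`, written as a face of `vσ`. -/
theorem IsForm.face_cons_eq_update {X : SComplex V} {d : ℕ} {f : (Fin (d + 1) → V) → ℝ}
    (hf : X.IsForm (d + 1) f) (σ : Fin (d + 1) → V) (v : V) (i : Fin (d + 1)) :
    (-1 : ℝ) ^ (i : ℕ) * f ((Fin.cons v σ : Fin (d + 2) → V) ∘ Fin.succAbove i.succ) =
      f (Function.update σ i v) := by
  have hface : (Fin.cons v σ : Fin (d + 2) → V) ∘ Fin.succAbove i.succ =
      Fin.cons v (i.removeNth σ) := by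
    funext j
    cases j using Fin.cases <;> simp [Fin.removeNth]
  have hupd : Function.update σ i v =
      (Fin.cons v (i.removeNth σ) : Fin (d + 1) → V) ∘ i.cycleRange := by
    rw [Fin.cons_comp_cycleRange, Fin.insertNth_removeNth]
  rw [hface, hupd, hf.1, Fin.sign_cycleRange]
  push_cast
  rfl

theorem IsForm.localUpLap_eq {X : SComplex V} {d : ℕ} {f : (Fin (d + 1) → V) → ℝ}
    (hf : X.IsForm (d + 1) f) (τ : Finset V) (σ : Fin (d + 1) → V) :
    X.localUpLap d τ f σ = if τ ⊆ tset σ then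
      (X.degTau τ (tset σ) : ℝ) * f σ -
        ∑ v : V, if X.nbr v σ then
          ∑ i : Fin (d + 1), if σ i ∉ τ then f (Function.update σ i v) else 0
        else 0
    else 0 := by
  simp only [localUpLap, hf.face_cons_eq_update]

theorem IsForm.localUpLap_comp_perm {X : SComplex V} {d : ℕ} {f : (Fin (d + 1) → V) → ℝ}
    (hf : X.IsForm (d + 1) f) (τ : Finset V) (σ : Fin (d + 1) → V)
    (π : Equiv.Perm (Fin (d + 1))) :
    X.localUpLap d τ f (σ ∘ π) =
      ((Equiv.Perm.sign π : ℤ) : ℝ) * X.localUpLap d τ f σ := by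
  have hsum : ∀ v, (∑ i, if (σ ∘ π) i ∉ τ then f (Function.update (σ ∘ π) i v) else 0) =
      ((Equiv.Perm.sign π : ℤ) : ℝ) *
        ∑ i, if σ i ∉ τ then f (Function.update σ i v) else 0 := fun v => by
    rw [mul_sum, ← Equiv.sum_comp π fun i =>
      ((Equiv.Perm.sign π : ℤ) : ℝ) * if σ i ∉ τ then f (Function.update σ i v) else 0]
    refine sum_congr rfl fun i _ => ?_
    rw [← Function.update_comp_eq_of_injective σ π.injective, hf.1, mul_ite, mul_zero]
    rfl
  simp only [hf.localUpLap_eq, nbr_comp_perm, tset_comp_perm, hsum, hf.1 σ π]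
  split_ifs
  · rw [mul_sub, mul_sum]
    simp only [mul_ite, mul_zero]
    ring
  · simp

theorem degTau_insert (X : SComplex V) {τ : Finset V} {w : V} (hw : w ∉ τ) :
    X.degTau τ (insert w τ) = (X.linkNbrs τ w).card := by
  symm
  refine card_bij (fun v _ => insert v τ) ?_ ?_ ?_
  · intro v hv
    simp only [linkNbrs, mem_filter, mem_univ, true_and] at hv
    obtain ⟨hvw, hvτ, -, hc⟩ := hv
    have hun : insert w τ ∪ insert v τ = insert w (insert v τ) := by grind
    refine mem_filter.2 ⟨X.down_closed _ hc _ (subset_insert _ _), ?_, ?_,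
      subset_insert _ _, ?_, hun ▸ hc⟩
    · rw [card_insert_of_notMem hvτ, card_insert_of_notMem hw]
    · intro h
      have : v ∈ insert w τ := h ▸ mem_insert_self v τ
      grind
    · rw [hun, card_insert_of_notMem (by grind), card_insert_of_notMem hvτ,
        card_insert_of_notMem hw]
  · intro v hv v' hv' h
    simp only [linkNbrs, mem_filter, mem_univ, true_and] at hv hv'
    have : v ∈ insert v' τ := h ▸ mem_insert_self v τ
    grind
  · intro s hs
    simp only [mem_filter] at hs
    obtain ⟨-, hcard, hne, hsub, -, hc⟩ := hs
    rw [card_insert_of_notMem hw] at hcard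
    obtain ⟨v, hv, rfl⟩ := exists_eq_insert_iff.2 ⟨hsub, hcard.symm⟩
    have hun : insert w τ ∪ insert v τ = insert w (insert v τ) := by grind
    refine ⟨v, ?_, rfl⟩
    simp only [linkNbrs, mem_filter, mem_univ, true_and]
    exact ⟨fun h => hne (by rw [h]), hv, hw, hun ▸ hc⟩

/-- On a cell `wt` containing the cell `t`, the local upper Laplacian of `f` agrees with the
graph Laplacian of the link of `t` applied to `v ↦ f (vt)`. -/
theorem IsForm.localUpLap_cons {X : SComplex V} {d : ℕ} {f : (Fin (d + 1) → V) → ℝ}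
    (hf : X.IsForm (d + 1) f) (t : Fin d → V) {w : V} (hw : w ∉ tset t) :
    X.localUpLap d (tset t) f (Fin.cons w t) =
      ((X.linkNbrs (tset t) w).card : ℝ) * f (Fin.cons w t) -
        ∑ v ∈ X.linkNbrs (tset t) w, f (Fin.cons v t) := by
  rw [hf.localUpLap_eq, tset_cons, if_pos (subset_insert _ _), degTau_insert X hw,
    linkNbrs, sum_filter]
  congr 1
  refine sum_congr rfl fun v _ => ?_
  have hnbr : X.nbr v (Fin.cons w t : Fin (d + 1) → V) ↔
      v ≠ w ∧ v ∉ tset t ∧ w ∉ tset t ∧ insert w (insert v (tset t)) ∈ X.cells := by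
    rw [nbr, tset_cons, insert_comm, mem_insert, not_or]
    tauto
  have hsum : (∑ i, if (Fin.cons w t : Fin (d + 1) → V) i ∉ tset t then
      f (Function.update (Fin.cons w t : Fin (d + 1) → V) i v) else 0) =
      f (Fin.cons v t) := by
    rw [Fin.sum_univ_succ]
    simp [hw, mem_tset, Fin.update_cons_zero]
  simp only [hnbr, hsum]

/-- A sum over ordered tuples of a permutation-invariant function supported on the cells
containing `t` is a sum over the vertices of the link of `t`. -/
theorem sum_eq_factorial_mul_sum_linkVerts (X : SComplex V) {d : ℕ} {t : Fin d → V}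
    (ht : Function.Injective t) (G : (Fin (d + 1) → V) → ℝ)
    (hperm : ∀ σ (π : Equiv.Perm (Fin (d + 1))), G (σ ∘ π) = G σ)
    (hsupp : ∀ σ, G σ ≠ 0 → X.IsCell σ ∧ tset t ⊆ tset σ) :
    ∑ σ, G σ = ((d + 1).factorial : ℝ) * ∑ v ∈ X.linkVerts (tset t), G (Fin.cons v t) := by
  have key : ∑ p ∈ X.linkVerts (tset t) ×ˢ (univ : Finset (Equiv.Perm (Fin (d + 1)))),
      G (Fin.cons p.1 t) = ∑ σ, G σ := by
    refine sum_of_injOn (fun p => (Fin.cons p.1 t : Fin (d + 1) → V) ∘ p.2) ?_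
      (fun _ _ => mem_coe.2 (mem_univ _)) ?_ fun p _ => (hperm _ _).symm
    · rintro ⟨v, π⟩ hv ⟨v', π'⟩ hv' h
      simp only [coe_product, Set.mem_prod, mem_coe, linkVerts, mem_filter, mem_univ,
        true_and, and_true] at hv hv'
      have hset := congrArg tset h
      simp only [tset_comp_perm, tset_cons] at hset
      have hvv : v = v' := by
        have : v ∈ insert v' (tset t) := hset ▸ mem_insert_self v _
        grind
      subst hvv
      have hππ : π = π' := Equiv.ext fun i =>
        cons_injective_of_notMem ht hv.1 (congrFun h i)
      rw [hππ]
    · intro σ _ hσ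
      by_contra hG
      obtain ⟨hcell, hsub⟩ := hsupp σ hG
      obtain ⟨v, hv, hvσ⟩ := exists_eq_insert_iff.2
        ⟨hsub, by rw [card_tset ht, card_tset hcell.1]⟩
      obtain ⟨π, hπ⟩ := exists_perm_of_tset_eq (ρ := (Fin.cons v t : Fin (d + 1) → V))
        hcell.1 (by rw [tset_cons, hvσ])
      refine hσ ⟨(v, π), ?_, hπ⟩
      simp only [coe_product, Set.mem_prod, mem_coe, linkVerts, mem_filter, mem_univ,
        true_and, and_true]
      exact ⟨hv, hvσ ▸ hcell.2⟩
  rw [← key, sum_product]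
  simp [mul_sum, Fintype.card_perm]

end SComplex

open SComplex in
/-- Garland's lemma, Lemma 4.2(2): for a form `f` on a `(d+1)`-dimensional complex and
an oriented cell `t` with `d` vertices, `⟨Δ⁺_τ f, f⟩ = ⟨Δ⁺_{lk τ} f_τ, f_τ⟩`, where
`f_τ(v) = f(vτ)` and `Δ⁺_{lk τ}` is the graph Laplacian of the link of `τ`. -/
theorem localUpLap_inner_eq_link (V : Type) [Fintype V] [DecidableEq V] (d : ℕ)
    (X : SComplex V) (hdim : X.Dim (d + 1))
    (f : (Fin (d + 1) → V) → ℝ) (hf : X.IsForm (d + 1) f)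
    (t : Fin d → V) (ht : X.IsCell t) :
    SComplex.innerForm (d + 1) (X.localUpLap d (SComplex.tset t) f) f =
      ∑ v ∈ X.linkVerts (SComplex.tset t),
        (((X.linkNbrs (SComplex.tset t) v).card : ℝ) * f (Fin.cons v t) -
            ∑ w ∈ X.linkNbrs (SComplex.tset t) v, f (Fin.cons w t)) *
          f (Fin.cons v t) := by
  rw [innerForm, X.sum_eq_factorial_mul_sum_linkVerts ht.1
    (fun σ => X.localUpLap d (tset t) f σ * f σ), inv_mul_cancel_left₀ (by positivity)]
  · refine sum_congr rfl fun v hv => ?_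
    rw [hf.localUpLap_cons t (mem_filter.1 hv).2.1]
  · intro σ π
    rw [hf.localUpLap_comp_perm, hf.1 σ π, mul_mul_mul_comm, sign_mul_self, one_mul]
  · intro σ hσ
    refine ⟨?_, ?_⟩ <;> by_contra h <;> apply hσ
    · rw [hf.2 σ h, mul_zero]
    · rw [localUpLap, if_neg h, zero_mul]
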